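/- arXiv:1709.05504 — 2 statements merged into one kernel-verified Lean document; each statement's English description precedes it below -/
import Mathlib

section
/- Suppose m and n are positive integers with m ≤ n, M is a connected m-dimensional manifold-with-boundary of class C¹, F : M → ℝⁿ is an immersion of class C¹, and σ is the intrinsic distance on M induced by F. Then for every 0 ≤ k < ∞ one has F_# ℋ^k_σ = ℋ^k ⌞ N(F,·); that is, for every subset A of ℝⁿ, ℋ^k_σ( F⁻¹[A] ) equals the upper integral ∫*_A N(F,x) dℋ^k x, where N(F,x) = card F⁻¹{x} and ℋ^k is k-dimensional Hausdorff measure on ℝⁿ. -/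
open Set Metric MeasureTheory
open scoped ENNReal Manifold Topology

noncomputable section

abbrev Euc (n : ℕ) : Type := EuclideanSpace ℝ (Fin n)

/-- Extended diameter of a set with respect to an `ℝ≥0∞`-valued distance function. -/
def ediamWith {X : Type*} (ρ : X → X → ℝ≥0∞) (s : Set X) : ℝ≥0∞ :=
  ⨆ x ∈ s, ⨆ y ∈ s, ρ x y

/-- The `d`-dimensional Hausdorff (outer) measure associated with an `ℝ≥0∞`-valued
distance function `ρ` (same normalisation as Mathlib's `μH[d]`, cf.
`MeasureTheory.hausdorffMeasure_apply`). -/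
def hausdorffWith {X : Type*} (ρ : X → X → ℝ≥0∞) (d : ℝ) (S : Set X) : ℝ≥0∞ :=
  ⨆ (δ : ℝ≥0∞) (_ : 0 < δ),
    ⨅ (t : ℕ → Set X) (_ : S ⊆ ⋃ i, t i) (_ : ∀ i, ediamWith ρ (t i) ≤ δ),
      ∑' i, ⨆ _ : (t i).Nonempty, ediamWith ρ (t i) ^ d

/-- The intrinsic distance on `M` induced by `F : M → ℝⁿ`. -/
def immersionDist {M : Type*} [TopologicalSpace M] {n : ℕ} (F : M → Euc n) (c z : M) : ℝ≥0∞ :=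
  ⨅ (C : ℝ → M) (_ : ContinuousOn C (Set.Icc 0 1)) (_ : C 0 = c) (_ : C 1 = z),
    eVariationOn (F ∘ C) (Set.Icc 0 1)

/-- The multiplicity function `N(F,x) = card F⁻¹{x}`, with values in `ℝ≥0∞`. -/
def multFun {M : Type*} {n : ℕ} (F : M → Euc n) (x : Euc n) : ℝ≥0∞ :=
  ∑' _ : (F ⁻¹' {x} : Set M), (1 : ℝ≥0∞)

/-- Upper integral of an arbitrary function with respect to a measure: the infimum of the
integrals of measurable majorants. -/
def upperLintegral {X : Type*} [MeasurableSpace X] (μ : Measure X) (f : X → ℝ≥0∞) : ℝ≥0∞ :=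
  ⨅ (g : X → ℝ≥0∞) (_ : Measurable g) (_ : ∀ x, f x ≤ g x), ∫⁻ x, g x ∂μ

section UpperIntegral

variable {X : Type*} [MeasurableSpace X]

theorem upperLintegral_indicator_tsum (μ : Measure X) (A : Set X) {E : ℕ → Set X}
    (hE : ∀ i, MeasurableSet (E i)) :
    upperLintegral μ (A.indicator fun x => ∑' i, (E i).indicator (fun _ => (1 : ℝ≥0∞)) x) =
      ∑' i, μ (A ∩ E i) := by
  have hmeas : ∀ G : ℕ → Set X, (∀ i, MeasurableSet (G i)) →
      Measurable fun x => ∑' i, (G i).indicator (fun _ => (1 : ℝ≥0∞)) x := fun G hG =>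
    Measurable.tsum fun i => measurable_const.indicator (hG i)
  have hint : ∀ (ν : Measure X) (G : ℕ → Set X), (∀ i, MeasurableSet (G i)) →
      ∫⁻ x, ∑' i, (G i).indicator (fun _ => (1 : ℝ≥0∞)) x ∂ν = ∑' i, ν (G i) := by
    intro ν G hG
    rw [lintegral_tsum fun i => (measurable_const.indicator (hG i)).aemeasurable]
    simp [lintegral_indicator (hG _)]
  apply le_antisymm
  · refine (iInf₂_le_of_le _ (hmeas _ fun i => measurableSet_toMeasurable μ (A ∩ E i)) <|
      iInf_le_of_le ?_ ?_)
    · intro x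
      by_cases hx : x ∈ A
      · rw [indicator_of_mem hx]
        refine ENNReal.tsum_le_tsum fun i => ?_
        by_cases hi : x ∈ E i
        · rw [indicator_of_mem hi, indicator_of_mem (subset_toMeasurable μ (A ∩ E i) ⟨hx, hi⟩)]
        · simp [hi]
      · simp [hx]
    · rw [hint _ _ fun i => measurableSet_toMeasurable μ (A ∩ E i)]
      simp
  · refine le_iInf₂ fun g hg => le_iInf fun hle => ?_
    have hae : ∀ᵐ x ∂μ.restrict A, ∑' i, (E i).indicator (fun _ => (1 : ℝ≥0∞)) x ≤ g x := by
      refine (ae_restrict_iff (measurableSet_le (hmeas E hE) hg)).2 (.of_forall fun x hx => ?_)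
      simpa [hx] using hle x
    calc ∑' i, μ (A ∩ E i) = ∑' i, μ.restrict A (E i) := by
          simp [Measure.restrict_apply (hE _), inter_comm]
      _ = ∫⁻ x, ∑' i, (E i).indicator (fun _ => (1 : ℝ≥0∞)) x ∂μ.restrict A := (hint _ _ hE).symm
      _ ≤ ∫⁻ x, g x ∂μ.restrict A := lintegral_mono_ae hae
      _ ≤ ∫⁻ x, g x ∂μ := lintegral_mono' Measure.restrict_le_self le_rfl

end UpperIntegral

theorem multFun_eq_tsum {X : Type*} {n : ℕ} (F : X → Euc n) {B : ℕ → Set X}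
    (hdisj : Pairwise (Function.onFun Disjoint B)) (hcov : ⋃ i, B i = univ)
    (hinj : ∀ i, InjOn F (B i)) :
    multFun F = fun x => ∑' i, (F '' B i).indicator (fun _ => (1 : ℝ≥0∞)) x := by
  classical
  funext x
  have hone : ∀ p : X, ∑' i, (B i).indicator (fun _ => (1 : ℝ≥0∞)) p = 1 := by
    intro p
    obtain ⟨i, hi⟩ := mem_iUnion.1 (hcov ▸ mem_univ p : p ∈ ⋃ i, B i)
    rw [tsum_eq_single i, indicator_of_mem hi]
    intro j hj
    exact indicator_of_notMem (fun h => (hdisj hj).le_bot ⟨h, hi⟩) _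
  calc multFun F x
      = ∑' p : (F ⁻¹' {x} : Set X), ∑' i, (B i).indicator (fun _ => (1 : ℝ≥0∞)) p.1 := by
        simp only [hone, multFun]
    _ = ∑' i, ∑' p : (F ⁻¹' {x} : Set X), (B i).indicator (fun _ => (1 : ℝ≥0∞)) p.1 :=
        ENNReal.tsum_comm
    _ = _ := by
        refine tsum_congr fun i => ?_
        by_cases hx : x ∈ F '' B i
        · obtain ⟨p, hp, rfl⟩ := hx
          rw [indicator_of_mem (mem_image_of_mem F hp),
            tsum_eq_single (⟨p, rfl⟩ : (F ⁻¹' {F p} : Set X)), indicator_of_mem hp]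
          rintro ⟨q, hq⟩ hne
          refine indicator_of_notMem (fun h => hne ?_) _
          exact Subtype.ext (hinj i h hp hq)
        · rw [indicator_of_notMem hx, ENNReal.tsum_eq_zero]
          rintro ⟨q, hq⟩
          exact indicator_of_notMem (fun h => hx ⟨q, h, hq⟩) _

/-- A `1`-Lipschitz map which, for every `ε > 0`, is `(1 + ε)`-bilipschitz on the pieces of a
countable Borel partition satisfies the area formula for Hausdorff measures. -/
theorem hausdorffMeasure_preimage_eq_upperLintegral {X : Type*} [EMetricSpace X]
    [MeasurableSpace X] [BorelSpace X] {n : ℕ} {F : X → Euc n} (hF : LipschitzWith 1 F)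
    (hB : ∀ ε : NNReal, 0 < ε → ∃ B : ℕ → Set X, Pairwise (Function.onFun Disjoint B) ∧
      ⋃ i, B i = univ ∧ (∀ i, MeasurableSet (B i)) ∧ (∀ i, MeasurableSet (F '' B i)) ∧
      ∀ i, ∀ x ∈ B i, ∀ y ∈ B i, edist x y ≤ (1 + ε : NNReal) * edist (F x) (F y))
    {k : ℝ} (hk : 0 ≤ k) (A : Set (Euc n)) :
    μH[k] (F ⁻¹' A) = upperLintegral μH[k] (A.indicator (multFun F)) := by
  have key : ∀ ε : NNReal, 0 < ε →
      upperLintegral μH[k] (A.indicator (multFun F)) ≤ μH[k] (F ⁻¹' A) ∧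
      μH[k] (F ⁻¹' A) ≤ ((1 + ε : NNReal) : ℝ≥0∞) ^ k *
        upperLintegral μH[k] (A.indicator (multFun F)) := by
    intro ε hε
    obtain ⟨B, hdisj, hcov, hBm, hFBm, hBε⟩ := hB ε hε
    have hinj : ∀ i, InjOn F (B i) := by
      intro i x hx y hy hxy
      have := hBε i x hx y hy
      rw [hxy, edist_self, mul_zero] at this
      exact edist_le_zero.1 this
    have hsum : μH[k] (F ⁻¹' A) = ∑' i, μH[k] (F ⁻¹' A ∩ B i) := by
      have h := measure_iUnion hdisj hBm (μ := (μH[k] : Measure X).restrict (F ⁻¹' A))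
      rw [hcov, Measure.restrict_apply MeasurableSet.univ, univ_inter] at h
      rw [h]
      simp [Measure.restrict_apply (hBm _), inter_comm]
    have himg : ∀ i, F '' (F ⁻¹' A ∩ B i) = A ∩ F '' B i := fun i => image_preimage_inter F (B i) A
    rw [multFun_eq_tsum F hdisj hcov hinj, upperLintegral_indicator_tsum _ _ hFBm, hsum]
    constructor
    · refine ENNReal.tsum_le_tsum fun i => ?_
      rw [← himg]
      simpa using hF.hausdorffMeasure_image_le hk (F ⁻¹' A ∩ B i)
    · rw [← ENNReal.tsum_mul_left]
      refine ENNReal.tsum_le_tsum fun i => ?_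
      rcases isEmpty_or_nonempty X with hX | hX
      · simp [Set.eq_empty_of_isEmpty]
      have hleft : ∀ x ∈ B i, Function.invFunOn F (B i) (F x) = x := fun x hx =>
        (hinj i).leftInvOn_invFunOn hx
      have hlip : LipschitzOnWith (1 + ε) (Function.invFunOn F (B i)) (A ∩ F '' B i) := by
        rintro _ ⟨-, x, hx, rfl⟩ _ ⟨-, y, hy, rfl⟩
        rw [hleft x hx, hleft y hy]
        exact hBε i x hx y hy
      have himg' : Function.invFunOn F (B i) '' (A ∩ F '' B i) = F ⁻¹' A ∩ B i := by
        rw [← himg, image_image]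
        exact (image_congr fun x hx => hleft x hx.2).trans (image_id' _)
      simpa only [himg'] using hlip.hausdorffMeasure_image_le hk
  refine le_antisymm ?_ (key 1 one_pos).1
  set T := upperLintegral μH[k] (A.indicator (multFun F))
  have hlim : Filter.Tendsto (fun ε : NNReal => ((1 + ε : NNReal) : ℝ≥0∞) ^ k * T) (𝓝[>] 0)
      (𝓝 (((1 + 0 : NNReal) : ℝ≥0∞) ^ k * T)) := by
    refine ENNReal.Tendsto.mul_const ?_ (.inl (by simp))
    have h1 : Filter.Tendsto (fun ε : NNReal => 1 + ε) (𝓝[>] 0) (𝓝 (1 + 0)) :=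
      ((continuous_const.add continuous_id).tendsto 0).mono_left nhdsWithin_le_nhds
    exact (ENNReal.continuous_rpow_const.tendsto _).comp (ENNReal.tendsto_coe.2 h1)
  have h := ge_of_tendsto hlim (by
    filter_upwards [self_mem_nhdsWithin] with ε hε using (key ε hε).2)
  simpa using h

section ImmersionDist

variable {M : Type*} [TopologicalSpace M] {n : ℕ} (F : M → Euc n)

theorem immersionDist_self (c : M) : immersionDist F c c = 0 := by
  refine le_antisymm ?_ zero_le
  refine iInf₂_le_of_le (fun _ => c) continuousOn_const (iInf₂_le_of_le rfl rfl ?_)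
  refine (eVariationOn.constant_on ?_).le
  rintro _ ⟨s, -, rfl⟩ _ ⟨t, -, rfl⟩
  rfl

theorem immersionDist_comm_le (c z : M) : immersionDist F c z ≤ immersionDist F z c := by
  refine le_iInf₂ fun C hC => le_iInf₂ fun h0 h1 => ?_
  have hmaps : MapsTo (fun t : ℝ => 1 - t) (Icc 0 1) (Icc 0 1) := fun t ht =>
    ⟨by linarith [ht.2], by linarith [ht.1]⟩
  refine iInf₂_le_of_le (C ∘ fun t => 1 - t)
    (hC.comp (by fun_prop) hmaps) (iInf₂_le_of_le (by simpa) (by simpa) ?_)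
  exact eVariationOn.comp_le_of_antitoneOn (F ∘ C) (fun t : ℝ => 1 - t)
    (fun s _ t _ hst => sub_le_sub_left hst 1) hmaps

theorem immersionDist_triangle (c w z : M) :
    immersionDist F c z ≤ immersionDist F c w + immersionDist F w z := by
  simp only [immersionDist, ENNReal.iInf_add, ENNReal.add_iInf]
  refine le_iInf₂ fun D hD => le_iInf₂ fun k0 k1 => le_iInf₂ fun C hC => le_iInf₂ fun h0 h1 => ?_
  set P : ℝ → M := fun t => if t ≤ 1 / 2 then C (2 * t) else D (2 * t - 1) with hP
  have hm₁ : MapsTo (fun t : ℝ => 2 * t) (Icc 0 (1 / 2)) (Icc 0 1) := fun t ht =>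
    ⟨by linarith [ht.1], by linarith [ht.2]⟩
  have hm₂ : MapsTo (fun t : ℝ => 2 * t - 1) (Icc (1 / 2) 1) (Icc 0 1) := fun t ht =>
    ⟨by linarith [ht.1], by linarith [ht.2]⟩
  have he₁ : EqOn P (C ∘ fun t => 2 * t) (Icc 0 (1 / 2)) := fun t ht => if_pos ht.2
  have he₂ : EqOn P (D ∘ fun t => 2 * t - 1) (Icc (1 / 2) 1) := by
    intro t ht
    rcases ht.1.eq_or_lt with rfl | h
    · simp [hP, h1, k0]
    · exact if_neg h.not_ge
  have hunion : Icc (0 : ℝ) (1 / 2) ∪ Icc (1 / 2) 1 = Icc 0 1 :=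
    Icc_union_Icc_eq_Icc (by norm_num) (by norm_num)
  have hcont : ContinuousOn P (Icc 0 1) := by
    rw [← hunion]
    exact ((hC.comp (by fun_prop) hm₁).congr he₁).union_of_isClosed
      ((hD.comp (by fun_prop) hm₂).congr he₂) isClosed_Icc isClosed_Icc
  refine iInf₂_le_of_le P hcont (iInf₂_le_of_le ?_ ?_ ?_)
  · simp [hP, h0]
  · have : ¬ (1 : ℝ) ≤ 1 / 2 := by norm_num
    simp only [hP, if_neg this]
    norm_num [k1]
  have hsplit := eVariationOn.Icc_add_Icc (F ∘ P) (s := univ) (a := (0 : ℝ)) (b := 1 / 2) (c := 1)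
    (by norm_num) (by norm_num) (mem_univ _)
  simp only [univ_inter] at hsplit
  rw [← hsplit, eVariationOn.eq_of_eqOn (he₁.comp_left (g := F)),
    eVariationOn.eq_of_eqOn (he₂.comp_left (g := F))]
  gcongr
  · exact eVariationOn.comp_le_of_monotoneOn (F ∘ C) _ (fun s _ t _ hst => by linarith) hm₁
  · exact eVariationOn.comp_le_of_monotoneOn (F ∘ D) _ (fun s _ t _ hst => by linarith) hm₂

theorem edist_le_immersionDist (c z : M) : edist (F c) (F z) ≤ immersionDist F c z := by
  refine le_iInf₂ fun C _ => le_iInf₂ fun h0 h1 => ?_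
  have := eVariationOn.edist_le (F ∘ C) (s := Icc (0 : ℝ) 1) (x := 0) (y := 1) (by simp) (by simp)
  simpa [h0, h1] using this

variable {F}

/-- A path leaving a compact neighbourhood of `p` on which `F` is injective has definite
variation. -/
theorem exists_pos_forall_immersionDist_lt [T2Space M] (hF : Continuous F) {p : M} {K : Set M}
    (hK : IsCompact K) (hp : K ∈ 𝓝 p) (hinj : InjOn F K) :
    ∃ r : ℝ≥0∞, 0 < r ∧ ∀ q, immersionDist F p q < r → q ∈ K := by
  have hfr : frontier K ⊆ K := hK.isClosed.frontier_subset
  have hpint : p ∈ interior K := mem_interior_iff_mem_nhds.2 hp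
  have hcpt : IsCompact (F '' frontier K) :=
    (hK.of_isClosed_subset isClosed_frontier hfr).image hF
  have hnot : F p ∉ F '' frontier K := by
    rintro ⟨q, hq, hpq⟩
    have : q = p := hinj (hfr hq) (mem_of_mem_nhds hp) hpq
    exact hq.2 (this ▸ hpint)
  refine ⟨infEDist (F p) (F '' frontier K), ?_, fun q hq => ?_⟩
  · rw [pos_iff_ne_zero]
    intro h
    exact hnot ((mem_iff_infEDist_zero_of_closed hcpt.isClosed).2 h)
  · by_contra hqK
    refine hq.not_ge (le_iInf₂ fun C hC => le_iInf₂ fun h0 h1 => ?_)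
    have hconn : IsPreconnected (C '' Icc 0 1) := isPreconnected_Icc.image C hC
    have hmeet : (C '' Icc 0 1 ∩ frontier K).Nonempty := by
      by_contra hempty
      obtain ⟨x, -, hx, hx'⟩ := hconn (interior K) Kᶜ isOpen_interior hK.isClosed.isOpen_compl
        (fun x hx => by
          by_contra hx'
          rw [mem_union, not_or, notMem_compl_iff] at hx'
          exact hempty ⟨x, hx, subset_closure hx'.2, hx'.1⟩)
        ⟨p, ⟨0, by simp, h0⟩, hpint⟩ ⟨q, ⟨1, by simp, h1⟩, hqK⟩
      exact hx' (interior_subset hx)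
    obtain ⟨_, ⟨t, ht, rfl⟩, htf⟩ := hmeet
    refine (infEDist_le_edist_of_mem (mem_image_of_mem F htf)).trans ?_
    have := eVariationOn.edist_le (F ∘ C) (s := Icc (0 : ℝ) 1) (x := 0) (y := t) (by simp) ht
    simpa [h0] using this

end ImmersionDist

section LocalEstimate

variable {E : Type*} [NormedAddCommGroup E] [NormedSpace ℝ E]
  {H : Type*} [TopologicalSpace H] {I : ModelWithCorners ℝ E H}
  {M : Type*} [TopologicalSpace M] [ChartedSpace H M] {n : ℕ}

theorem ContDiffWithinAt.exists_lipschitzOnWith_sub_fderivWithin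
    {V : Type*} [NormedAddCommGroup V] [NormedSpace ℝ V] {G : E → V} {s : Set E} {a : E}
    (hG : ContDiffWithinAt ℝ 1 G s a) (hs : Convex ℝ s) (hu : UniqueDiffWithinAt ℝ s a)
    (ha : a ∈ s) {η : NNReal} (hη : 0 < η) :
    ∃ t ∈ 𝓝[s] a, LipschitzOnWith η (fun y => G y - fderivWithin ℝ G s a y) t := by
  obtain ⟨u, hus, -, -, f', hf', hcont⟩ :=
    (contDiffWithinAt_succ_iff_hasFDerivWithinAt' (n := 0) (by simp)).1 (by simpa using hG)
  rw [insert_eq_of_mem ha] at hus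
  set L := fderivWithin ℝ G s a with hL
  have hfa : f' a = L := ((hf' a (mem_of_mem_nhdsWithin ha hus)).fderivWithin hu).symm
  refine hs.exists_nhdsWithin_lipschitzOnWith_of_hasFDerivWithinAt_of_nnnorm_lt
    (f' := fun y => f' y - L) ?_ ?_ η (by simpa [hfa] using hη)
  · filter_upwards [hus] with y hy using (hf' y hy).sub L.hasFDerivWithinAt
  · exact hcont.continuousWithinAt.sub continuousWithinAt_const

/-- Near each point, an immersion of class `C¹` is almost an isometry for its intrinsic
distance. -/
theorem exists_nhds_injOn_immersionDist_le [FiniteDimensional ℝ E] {F : M → Euc n} {p : M}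
    (hF : ContMDiffAt I 𝓘(ℝ, Euc n) 1 F p)
    (hImm : Function.Injective (mfderiv I 𝓘(ℝ, Euc n) F p)) {ε : NNReal} (hε : 0 < ε) :
    ∃ U ∈ 𝓝 p, InjOn F U ∧
      ∀ x ∈ U, ∀ y ∈ U, immersionDist F x y ≤ (1 + ε : NNReal) * edist (F x) (F y) := by
  set φ := extChartAt I p with hφ
  set G : E → Euc n := F ∘ φ.symm with hGdef
  have hG : ContDiffWithinAt ℝ 1 G (range I) (φ p) := by
    exact (contMDiffAt_iff.1 hF).2
  have hpr : φ p ∈ range I := extChartAt_target_subset_range p (mem_extChartAt_target p)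
  set L := fderivWithin ℝ G (range I) (φ p) with hLdef
  have hL : Function.Injective L := by
    have h : mfderiv I 𝓘(ℝ, Euc n) F p = L := if_pos (hF.mdifferentiableAt one_ne_zero)
    rwa [h] at hImm
  obtain ⟨K, K0, hK⟩ := (L : E →ₗ[ℝ] Euc n).injective_iff_antilipschitz.1 hL
  have hKL : ∀ v, ‖v‖ ≤ K * ‖L v‖ := fun v =>
    ZeroHomClass.bound_of_antilipschitz (L : E →ₗ[ℝ] Euc n) hK v
  set η : NNReal := ε / (2 + ε) / K with hη
  have hη0 : 0 < η := by positivity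
  have hηK : (η * K : ℝ) = ε / (2 + ε) := by
    rw [hη]
    push_cast
    have : (K : ℝ) ≠ 0 := by exact_mod_cast K0.ne'
    field_simp
  obtain ⟨t, ht, hlip⟩ := hG.exists_lipschitzOnWith_sub_fderivWithin I.convex_range
    (I.uniqueDiffOn _ hpr) hpr hη0
  obtain ⟨r, r0, hr⟩ := mem_nhdsWithin_iff.1
    (Filter.inter_mem ht (extChartAt_target_mem_nhdsWithin (I := I) p))
  set S := ball (φ p) r ∩ range I with hS
  have hSconv : Convex ℝ S := (convex_ball _ _).inter I.convex_range
  have hdiff : ∀ a ∈ S, ∀ b ∈ S, ‖G a - G b - L (a - b)‖ ≤ η * (K * ‖L (a - b)‖) := by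
    intro a ha b hb
    have h := hlip.norm_sub_le (hr ha).1 (hr hb).1
    rw [show G a - G b - L (a - b) = G a - L a - (G b - L b) by rw [map_sub]; abel]
    exact h.trans (by gcongr; exact hKL _)
  have hlow : ∀ a ∈ S, ∀ b ∈ S, ‖L (a - b)‖ * (1 - η * K) ≤ ‖G a - G b‖ := by
    intro a ha b hb
    have h1 := hdiff a ha b hb
    have h2 := norm_sub_norm_le (L (a - b)) (G a - G b)
    rw [norm_sub_rev (L (a - b))] at h2
    linarith
  have hupp : ∀ a ∈ S, ∀ b ∈ S, ‖G a - G b‖ ≤ (1 + η * K) * ‖L (a - b)‖ := by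
    intro a ha b hb
    have h1 := hdiff a ha b hb
    have h2 := norm_sub_norm_le (G a - G b) (L (a - b))
    linarith
  have hFG : ∀ x ∈ φ.source, G (φ x) = F x := fun x hx => by simp [hGdef, φ.left_inv hx]
  have hε' : (0 : ℝ) < ε := hε
  have hηK1 : (0 : ℝ) < 1 - η * K := by
    rw [hηK, sub_pos, div_lt_one (by positivity)]
    linarith
  refine ⟨φ.source ∩ φ ⁻¹' S, ?_, ?_, ?_⟩
  · refine Filter.inter_mem (extChartAt_source_mem_nhds p) ?_
    have : S ∈ Filter.map φ (𝓝 p) := by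
      rw [map_extChartAt_nhds, hS, inter_comm]
      exact inter_mem_nhdsWithin _ (ball_mem_nhds _ r0)
    exact this
  · rintro x ⟨hx, hxS⟩ y ⟨hy, hyS⟩ hxy
    have h := hlow _ hxS _ hyS
    rw [hFG x hx, hFG y hy, hxy, sub_self, norm_zero] at h
    have h0 : ‖L (φ x - φ y)‖ = 0 :=
      le_antisymm (nonpos_of_mul_nonpos_left h hηK1) (norm_nonneg _)
    rw [norm_eq_zero, map_sub, sub_eq_zero] at h0
    exact φ.injOn hx hy (hL h0)
  · rintro x ⟨hx, hxS⟩ y ⟨hy, hyS⟩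
    set γ : ℝ → E := fun t => AffineMap.lineMap (φ x) (φ y) t with hγ
    have hγS : MapsTo γ (Icc 0 1) S := fun t ht => hSconv.lineMap_mem hxS hyS ht
    have hcont : ContinuousOn (φ.symm ∘ γ) (Icc 0 1) :=
      (continuousOn_extChartAt_symm p).comp (AffineMap.lineMap_continuous.continuousOn)
        fun t ht => (hr (hγS ht)).2
    refine iInf₂_le_of_le (φ.symm ∘ γ) hcont (iInf₂_le_of_le ?_ ?_ ?_)
    · simp [hγ, φ.left_inv hx]
    · simp [hγ, φ.left_inv hy]
    set κ : NNReal := (1 + η * K) * ‖L (φ x - φ y)‖₊ with hκ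
    have hκlip : LipschitzOnWith κ (F ∘ φ.symm ∘ γ) (Icc 0 1) := by
      refine LipschitzOnWith.of_dist_le_mul fun s hs t ht => ?_
      have hst : γ s - γ t = (t - s) • (φ x - φ y) := by
        simp only [hγ, AffineMap.lineMap_apply_module]
        module
      rw [dist_eq_norm, dist_eq_norm]
      refine (hupp _ (hγS hs) _ (hγS ht)).trans (le_of_eq ?_)
      rw [hst, map_smul, norm_smul, hκ, norm_sub_rev t s]
      push_cast
      ring
    have hvar : eVariationOn (F ∘ φ.symm ∘ γ) (Icc 0 1) ≤ κ := by
      refine (hκlip.comp_eVariationOn_le (g := id) (mapsTo_id _)).trans ?_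
      calc (κ : ℝ≥0∞) * eVariationOn id (Icc (0 : ℝ) 1) ≤ κ * 1 := by
            gcongr
            simp
        _ = κ := mul_one _
    refine hvar.trans ?_
    rw [edist_nndist, ← ENNReal.coe_mul, ENNReal.coe_le_coe, ← NNReal.coe_le_coe, hκ]
    push_cast
    rw [dist_eq_norm, ← hFG x hx, ← hFG y hy]
    have h := hlow _ hxS _ hyS
    calc (1 + η * K : ℝ) * ‖L (φ x - φ y)‖
        = (1 + ε) * (‖L (φ x - φ y)‖ * (1 - η * K)) := by
          rw [hηK]
          field_simp
          ring
      _ ≤ (1 + ε) * ‖G (φ x) - G (φ y)‖ := by gcongr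

end LocalEstimate

/-- A copy of `M` to be endowed with the intrinsic distance induced by `F`. -/
def IntrinsicSpace {M : Type*} {n : ℕ} (_F : M → Euc n) : Type _ := M

theorem exists_measurable_partition {M : Type*} [TopologicalSpace M] [T2Space M]
    [SecondCountableTopology M] [LocallyCompactSpace M] [Nonempty M] {n : ℕ} {F : M → Euc n}
    (hF : Continuous F) {P : Set M → Prop} (hP : ∀ ⦃s t⦄, s ⊆ t → P t → P s)
    (hloc : ∀ p, ∃ U ∈ 𝓝 p, InjOn F U ∧ P U) {m : MeasurableSpace M}
    (hm : ∀ K : Set M, IsCompact K → MeasurableSet K) :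
    ∃ B : ℕ → Set M, Pairwise (Function.onFun Disjoint B) ∧ ⋃ i, B i = univ ∧
      (∀ i, MeasurableSet (B i)) ∧ (∀ i, MeasurableSet (F '' B i)) ∧ ∀ i, P (B i) := by
  have hcpt : ∀ p, ∃ K ∈ 𝓝 p, IsCompact K ∧ InjOn F K ∧ P K := by
    intro p
    obtain ⟨U, hU, hinj, hPU⟩ := hloc p
    obtain ⟨K, hK, hKU, hKc⟩ := local_compact_nhds hU
    exact ⟨K, hK, hKc, hinj.mono hKU, hP hKU hPU⟩
  choose N hN hNc hNinj hNP using hcpt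
  obtain ⟨s, hs, hcov⟩ := TopologicalSpace.countable_cover_nhds hN
  have hne : s.Nonempty := by
    rw [nonempty_iff_ne_empty]
    rintro rfl
    simp only [mem_empty_iff_false, iUnion_of_empty, iUnion_empty] at hcov
    exact empty_ne_univ hcov
  obtain ⟨e, rfl⟩ := hs.exists_eq_range hne
  rw [biUnion_range] at hcov
  refine ⟨disjointed fun i => N (e i), disjoint_disjointed _, ?_, fun i => ?_, fun i => ?_,
    fun i => hP (disjointed_subset _ i) (hNP _)⟩
  · rw [iUnion_disjointed, hcov]
  · exact .disjointed (fun i => hm _ (hNc (e i))) i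
  · refine (disjointedRec (f := fun i => N (e i))
      (p := fun t => t ⊆ N (e i) ∧ MeasurableSet (F '' t)) ?_
      ⟨subset_rfl, ((hNc (e i)).image hF).measurableSet⟩).2
    rintro t j ⟨ht, htm⟩
    refine ⟨sdiff_subset.trans ht, ?_⟩
    have : F '' (t \ N (e j)) = F '' t \ F '' (N (e i) ∩ N (e j)) := by
      ext y
      constructor
      · rintro ⟨x, ⟨hx, hxj⟩, rfl⟩
        refine ⟨mem_image_of_mem F hx, ?_⟩
        rintro ⟨z, ⟨hzi, hzj⟩, hz⟩
        exact hxj (hNinj (e i) hzi (ht hx) hz ▸ hzj)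
      · rintro ⟨⟨x, hx, rfl⟩, hxn⟩
        exact ⟨x, ⟨hx, fun hxj => hxn ⟨x, ⟨ht hx, hxj⟩, rfl⟩⟩, rfl⟩
    rw [this]
    exact htm.diff (((hNc (e i)).inter (hNc (e j))).image hF).measurableSet

/-- The area formula for the intrinsic distance of a map which is locally almost isometric. -/
theorem hausdorffWith_immersionDist_preimage {M : Type*} [TopologicalSpace M] [T2Space M]
    [SecondCountableTopology M] [LocallyCompactSpace M] [Nonempty M] {n : ℕ} {F : M → Euc n}
    (hF : Continuous F)
    (hloc : ∀ ε : NNReal, 0 < ε → ∀ p, ∃ U ∈ 𝓝 p, InjOn F U ∧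
      ∀ x ∈ U, ∀ y ∈ U, immersionDist F x y ≤ (1 + ε : NNReal) * edist (F x) (F y))
    {k : ℝ} (hk : 0 ≤ k) (A : Set (Euc n)) :
    hausdorffWith (immersionDist F) k (F ⁻¹' A) =
      upperLintegral μH[k] (A.indicator (multFun F)) := by
  have hnhds : ∀ p, ∀ U ∈ 𝓝 p, ∃ r : ℝ≥0∞, 0 < r ∧ ∀ q, immersionDist F p q < r → q ∈ U := by
    intro p U hU
    obtain ⟨V, hV, hinj, -⟩ := hloc 1 one_pos p
    obtain ⟨K, hK, hKUV, hKc⟩ := local_compact_nhds (Filter.inter_mem hU hV)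
    obtain ⟨r, hr, h⟩ := exists_pos_forall_immersionDist_lt hF hKc hK
      (hinj.mono (hKUV.trans inter_subset_right))
    exact ⟨r, hr, fun q hq => (hKUV (h q hq)).1⟩
  let _ : EMetricSpace (IntrinsicSpace F) :=
    { edist := immersionDist (M := M) F
      edist_self := immersionDist_self (M := M) F
      edist_comm := fun (c z : M) =>
        le_antisymm (immersionDist_comm_le F c z) (immersionDist_comm_le F z c)
      edist_triangle := immersionDist_triangle (M := M) F
      eq_of_edist_eq_zero := by
        intro (p : M) (q : M) (hpq : immersionDist F p q = 0)
        by_contra hne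
        obtain ⟨r, hr, h⟩ := hnhds p {q}ᶜ (isOpen_compl_singleton.mem_nhds hne)
        exact h q (hpq ▸ hr) rfl }
  let _ : MeasurableSpace (IntrinsicSpace F) := borel _
  have : BorelSpace (IntrinsicSpace F) := ⟨rfl⟩
  have hclosed : ∀ K : Set M, IsCompact K → IsClosed (X := IntrinsicSpace F) K := by
    intro K hK
    refine ⟨EMetric.isOpen_iff.2 fun (p : M) (hp : p ∉ K) => ?_⟩
    obtain ⟨r, hr, h⟩ := hnhds p Kᶜ (hK.isClosed.isOpen_compl.mem_nhds hp)
    exact ⟨r, hr, fun (q : M) (hq : immersionDist F q p < r) =>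
      h q ((immersionDist_comm_le F p q).trans_lt hq)⟩
  have hFlip : LipschitzWith (α := IntrinsicSpace F) 1 F := by
    intro (c : M) (z : M)
    rw [ENNReal.coe_one, one_mul]
    exact edist_le_immersionDist F c z
  refine (Measure.hausdorffMeasure_apply (X := IntrinsicSpace F) k (F ⁻¹' A)).symm.trans ?_
  refine hausdorffMeasure_preimage_eq_upperLintegral hFlip (fun ε hε => ?_) hk A
  exact exists_measurable_partition (M := M) hF
    (P := fun U => ∀ x ∈ U, ∀ y ∈ U, immersionDist F x y ≤ (1 + ε : NNReal) * edist (F x) (F y))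
    (fun s t hst h x hx y hy => h x (hst hx) y (hst hy)) (hloc ε hε)
    (m := (inferInstance : MeasurableSpace (IntrinsicSpace F)))
    fun K hK => (hclosed K hK).measurableSet

/-- **area formula for the intrinsic Hausdorff measures.** Let `M` be a
connected `m`-dimensional manifold-with-boundary of class `C¹`, `F : M → ℝⁿ` a `C¹`
immersion (`m ≤ n`), and `σ` the intrinsic distance induced by `F`.  Then for every
`0 ≤ k < ∞` and every `A ⊆ ℝⁿ`, `ℋ^k_σ(F⁻¹[A])` equals the upper integral
`∫*_A N(F,x) dℋ^k x`, where `N(F,x) = card F⁻¹{x}`. -/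
theorem pushforward_hausdorff_eq (m n : ℕ) [NeZero m] (hm : 0 < m) (hn : 0 < n) (hmn : m ≤ n)
    (M : Type) [TopologicalSpace M] [T2Space M] [SecondCountableTopology M]
    [ChartedSpace (EuclideanHalfSpace m) M]
    [HasGroupoid M (contDiffGroupoid 1 (𝓡∂ m))] [ConnectedSpace M]
    (F : M → Euc n)
    (hF : ContMDiff (𝓡∂ m) 𝓘(ℝ, Euc n) 1 F)
    (hImm : ∀ x : M, Function.Injective (mfderiv (𝓡∂ m) 𝓘(ℝ, Euc n) F x))
    (k : ℝ) (hk : 0 ≤ k) :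
    ∀ A : Set (Euc n),
      hausdorffWith (immersionDist F) k (F ⁻¹' A) =
        upperLintegral (μH[k]) (A.indicator (multFun F)) := by
  intro A
  have : LocallyCompactSpace M := Manifold.locallyCompact_of_finiteDimensional (𝓡∂ m)
  exact hausdorffWith_immersionDist_preimage hF.continuous
    (fun ε hε p => exists_nhds_injOn_immersionDist_le hF.contMDiffAt (hImm p) hε) hk A

end
end

section
/- Suppose X is a closed subset of ℝⁿ, ε > 0, 0 ≤ s < ∞, 0 < δ ≤ 1, a ∈ X, and ζ : X → ℝ is defined by ζ(x) = max{ s − σ_δ(x,a), 0 } (with ζ(x) = 0 when σ_δ(x,a) = ∞). Then there exists a C^∞ compactly supported function Z : ℝⁿ → ℝ with Z ≥ 0 such that |Z(x) − ζ(x)| ≤ ε and |DZ(x)| ≤ 1 for every x ∈ X. -/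
open Set Metric
open scoped ENNReal

noncomputable section

/-- The chain pseudometric `σ_δ` on a set `X ⊆ ℝⁿ`: the infimum (possibly `∞`) of
`Σ |xᵢ − xᵢ₋₁|` over all finite chains in `X` from `a` to `x` with steps of length `≤ δ`. -/
def chainDist {n : ℕ} (X : Set (Euc n)) (δ : ℝ) (a x : Euc n) : ℝ≥0∞ :=
  ⨅ (j : ℕ) (p : ℕ → Euc n) (_ : ∀ i, i ≤ j → p i ∈ X) (_ : p 0 = a) (_ : p j = x)
    (_ : ∀ i, 1 ≤ i → i ≤ j → dist (p i) (p (i - 1)) ≤ δ),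
    ENNReal.ofReal (∑ i ∈ Finset.range j, dist (p (i + 1)) (p i))

open MeasureTheory Convolution in
/-- Mollification at a fixed scale, with an error and a derivative bound at every point around
which the original function is Lipschitz. -/
theorem exists_contDiff_mollification {E : Type*} [NormedAddCommGroup E] [InnerProductSpace ℝ E]
    [FiniteDimensional ℝ E] [MeasurableSpace E] [BorelSpace E] {F : E → ℝ} (hF : Continuous F)
    (hFs : HasCompactSupport F) (hF0 : ∀ z, 0 ≤ F z) {C r : ℝ} (hC : 0 ≤ C) (hr : 0 < r) :
    ∃ W : E → ℝ, ContDiff ℝ (⊤ : ℕ∞) W ∧ HasCompactSupport W ∧ (∀ z, 0 ≤ W z) ∧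
      ∀ x, (∀ z ∈ ball x r, ∀ w ∈ ball x r, F z ≤ F w + C * dist z w) →
        |W x - F x| ≤ C * r ∧ ‖fderiv ℝ W x‖ ≤ C := by
  let φ : ContDiffBump (0 : E) := ⟨r / 4, r / 2, by positivity, by linarith⟩
  let μ : Measure E := volume
  have hφs : Function.support (φ.normed μ) ⊆ ball 0 (r / 2) := φ.support_normed_eq.subset
  have hφ0 : ∀ z, 0 ≤ φ.normed μ z := φ.nonneg_normed
  have hφi : ∫ z, φ.normed μ z ∂μ = 1 := φ.integral_normed
  have habs : ∀ x, (∀ z ∈ ball x r, ∀ w ∈ ball x r, F z ≤ F w + C * dist z w) →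
      ∀ z ∈ ball x r, ∀ w ∈ ball x r, |F z - F w| ≤ C * dist z w := by
    intro x h z hz w hw
    have h1 := h z hz w hw
    have h2 := h w hw z hz
    rw [dist_comm w z] at h2
    rw [abs_le]
    constructor <;> linarith
  have hconv : ∀ G : E → ℝ, Continuous G →
      ConvolutionExists (φ.normed μ) G (ContinuousLinearMap.lsmul ℝ ℝ) μ := fun G hG =>
    φ.hasCompactSupport_normed.convolutionExists_left _ φ.continuous_normed
      hG.locallyIntegrable
  refine ⟨φ.normed μ ⋆[ContinuousLinearMap.lsmul ℝ ℝ, μ] F, ?_, ?_, ?_, ?_⟩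
  · exact φ.hasCompactSupport_normed.contDiff_convolution_left _ φ.contDiff_normed
      hF.locallyIntegrable
  · exact φ.hasCompactSupport_normed.convolution _ hFs
  · intro z
    exact integral_nonneg fun t => mul_nonneg (hφ0 t) (hF0 _)
  · intro x hx
    have hx' := habs x hx
    constructor
    · rw [← Real.dist_eq]
      refine dist_convolution_le (by positivity) hφs hφ0 hφi hF.aestronglyMeasurable ?_
      intro z hz
      rw [mem_ball] at hz
      rw [Real.dist_eq]
      refine (hx' z (by rw [mem_ball]; linarith) x (mem_ball_self hr)).trans ?_
      gcongr
      linarith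
    · refine norm_fderiv_le_of_lip' ℝ hC ?_
      filter_upwards [ball_mem_nhds x (half_pos hr)] with u hu
      rw [mem_ball] at hu
      have hG : Continuous fun v => F (v + (u - x)) - F v := by fun_prop
      have key : (φ.normed μ ⋆[ContinuousLinearMap.lsmul ℝ ℝ, μ] F) u -
          (φ.normed μ ⋆[ContinuousLinearMap.lsmul ℝ ℝ, μ] F) x =
          (φ.normed μ ⋆[ContinuousLinearMap.lsmul ℝ ℝ, μ] fun v => F (v + (u - x)) - F v) x := by
        simp only [convolution_def]
        rw [← integral_sub (hconv F hF u) (hconv F hF x)]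
        refine integral_congr_ae (Filter.Eventually.of_forall fun t => ?_)
        have : x - t + (u - x) = u - t := by abel
        simp only [ContinuousLinearMap.lsmul_apply, smul_eq_mul, this]
        ring
      rw [key, ← dist_zero_right]
      refine dist_convolution_le (by positivity) hφs hφ0 hφi hG.aestronglyMeasurable ?_
      intro v hv
      rw [mem_ball] at hv
      have hd : dist (v + (u - x)) v = ‖u - x‖ := by simp [dist_eq_norm]
      rw [Real.dist_eq, sub_zero]
      refine (hx' _ ?_ v (by rw [mem_ball]; linarith)).trans_eq (by rw [hd])
      rw [mem_ball]
      have := dist_triangle (v + (u - x)) v x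
      rw [hd, ← dist_eq_norm] at this
      linarith

/-- A bounded function on a set which is 1-Lipschitz at scale `δ` extends to a continuous function
which is `(1 + η)`-Lipschitz on all balls of a uniform radius centred on the set. -/
theorem exists_continuous_extension_of_lipschitz_at_scale {α : Type*} [PseudoMetricSpace α]
    {X : Set α} (hX : X.Nonempty) {f : α → ℝ} {s δ η : ℝ} (hδ : 0 < δ) (hη : 0 < η)
    (hη1 : η ≤ 1) (hf0 : ∀ x ∈ X, 0 ≤ f x) (hfs : ∀ x ∈ X, f x ≤ s)
    (hf : ∀ x ∈ X, ∀ y ∈ X, dist x y ≤ δ → f y ≤ f x + dist x y) :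
    ∃ F : α → ℝ, Continuous F ∧ (∀ z, 0 ≤ F z) ∧
      (∀ z, 0 < F z → ∃ y ∈ X, 0 < f y ∧ dist z y ≤ s) ∧ (∀ x ∈ X, F x = f x) ∧
      ∀ x ∈ X, ∀ z ∈ ball x (η * δ / 20), ∀ w ∈ ball x (η * δ / 20),
        F z ≤ F w + (1 + η) * dist z w := by
  obtain ⟨a, ha⟩ := hX
  have hs : 0 ≤ s := (hf0 a ha).trans (hfs a ha)
  have : Nonempty X := ⟨⟨a, ha⟩⟩
  have hηδ : η * δ ≤ δ := by nlinarith
  have hηδ0 : 0 < η * δ := by positivity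
  obtain ⟨M, hM0, hM⟩ : ∃ M : ℝ, 0 ≤ M ∧ M * (δ / 4) = s :=
    ⟨s / (δ / 4), by positivity, by field_simp⟩
  -- The profile has slope `1 + η` up to `δ / 4`, and exceeds `s` from `δ / 2` on.
  let h : ℝ → ℝ := fun t => (1 + η) * t + M * max (t - δ / 4) 0
  have h_near : ∀ t, t ≤ δ / 4 → h t = (1 + η) * t := by
    intro t ht
    have : max (t - δ / 4) 0 = 0 := max_eq_right (by linarith)
    simp [h, this]
  have h_ge : ∀ t, (1 + η) * t ≤ h t := by
    intro t
    have : 0 ≤ M * max (t - δ / 4) 0 := mul_nonneg hM0 (le_max_right _ _)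
    simp only [h]
    linarith
  have h_far : ∀ t, δ / 2 ≤ t → s ≤ h t := by
    intro t ht
    have h1 : M * (δ / 4) ≤ M * max (t - δ / 4) 0 :=
      mul_le_mul_of_nonneg_left (le_max_of_le_left (by linarith)) hM0
    have h2 : 0 ≤ (1 + η) * t := mul_nonneg (by linarith) (by linarith)
    simp only [h]
    linarith
  have h_lip : ∀ t u d, 0 ≤ d → u ≤ t + d → h u ≤ h t + (1 + η + M) * d := by
    intro t u d hd htu
    have h1 : max (u - δ / 4) 0 ≤ max (t - δ / 4) 0 + d :=
      max_le (by linarith [le_max_left (t - δ / 4) 0]) (by linarith [le_max_right (t - δ / 4) 0])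
    have h2 := mul_le_mul_of_nonneg_left h1 hM0
    have h3 := mul_le_mul_of_nonneg_left htu (by linarith : 0 ≤ 1 + η)
    simp only [h]
    nlinarith
  let g : α → X → ℝ := fun z y => max 0 (f y - h (dist z y))
  have h_nn : ∀ z y : α, 0 ≤ h (dist z y) := fun z y =>
    (mul_nonneg (by linarith) dist_nonneg).trans (h_ge _)
  have hbdd : ∀ z, BddAbove (range (g z)) := by
    intro z
    refine ⟨s, ?_⟩
    rintro _ ⟨y, rfl⟩
    exact max_le hs (by linarith [hfs y y.2, h_nn z y])
  let F : α → ℝ := fun z => ⨆ y, g z y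
  have hgF : ∀ z y, g z y ≤ F z := fun z y => le_ciSup (hbdd z) y
  have hF0 : ∀ z, 0 ≤ F z := fun z => (le_max_left _ _).trans (hgF z ⟨a, ha⟩)
  have hle : ∀ z, ∀ y (hy : y ∈ X), f y - h (dist z y) ≤ F z := fun z y hy =>
    (le_max_right _ _).trans (hgF z ⟨y, hy⟩)
  refine ⟨F, ?_, hF0, ?_, ?_, ?_⟩
  · have : LipschitzWith (Real.toNNReal (1 + η + M)) F := by
      refine LipschitzWith.of_le_add_mul _ fun z w => ciSup_le fun y => ?_
      rw [Real.coe_toNNReal _ (by linarith)]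
      refine max_le (add_nonneg (hF0 w) (mul_nonneg (by linarith) dist_nonneg)) ?_
      have h1 := hle w y y.2
      have h2 := h_lip (dist z y) (dist w y) (dist z w) dist_nonneg
        (by linarith [dist_triangle w z y, dist_comm w z])
      linarith
    exact this.continuous
  · intro z hz
    obtain ⟨y, hy⟩ := exists_lt_of_lt_ciSup hz
    have hy' : 0 < f y - h (dist z y) := (lt_max_iff.1 hy).resolve_left (lt_irrefl _)
    have h1 := h_ge (dist z y)
    have h2 : 0 ≤ η * dist z y := mul_nonneg hη.le dist_nonneg
    exact ⟨y, y.2, by linarith [h_nn z y], by linarith [hfs y y.2]⟩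
  · intro x hx
    apply le_antisymm
    · refine ciSup_le fun y => max_le (hf0 x hx) ?_
      rcases le_or_gt (dist x y) δ with hxy | hxy
      · have h1 := hf x hx y y.2 hxy
        have h2 := h_ge (dist x y)
        have h3 : 0 ≤ η * dist x y := mul_nonneg hη.le dist_nonneg
        linarith
      · linarith [h_far (dist x y) (by linarith), hfs y y.2, hf0 x hx]
    · have := hle x x hx
      rw [dist_self, h_near 0 (by linarith)] at this
      linarith
  · intro x hx z hz w hw
    rw [mem_ball] at hz hw
    refine ciSup_le fun y => ?_
    have hzw : 0 ≤ (1 + η) * dist z w := mul_nonneg (by linarith) dist_nonneg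
    refine max_le (add_nonneg (hF0 w) hzw) ?_
    by_cases hnear : dist z y ≤ δ / 4 ∧ dist w y ≤ δ / 4
    · have h1 := hle w y y.2
      rw [h_near _ hnear.2] at h1
      rw [h_near _ hnear.1]
      have := mul_le_mul_of_nonneg_left (dist_triangle w z y) (by linarith : 0 ≤ 1 + η)
      rw [dist_comm w z] at this
      linarith
    · have hxz : dist x y ≤ dist z x + dist z y := dist_triangle_left _ _ _
      have hzx : dist z y ≤ dist z x + dist x y := dist_triangle _ _ _
      have hwx : dist w y ≤ dist w x + dist x y := dist_triangle _ _ _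
      have hxy : δ / 4 - η * δ / 20 ≤ dist x y := by
        by_contra! hlt
        exact hnear ⟨by linarith, by linarith⟩
      rcases le_or_gt (dist x y) δ with hd | hd
      · have h1 := hf x hx y y.2 hd
        have h2 := h_ge (dist z y)
        have h3 := hle w x hx
        rw [h_near _ (by linarith)] at h3
        have h4 := mul_le_mul_of_nonneg_left hxz (by linarith : 0 ≤ 1 + η)
        have h5 := mul_le_mul_of_nonneg_left hxy hη.le
        have h6 : (1 + η) * dist z x ≤ (1 + η) * (η * δ / 20) := by gcongr
        have h7 : (1 + η) * dist w x ≤ (1 + η) * (η * δ / 20) := by gcongr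
        have h8 : η * (η * δ) ≤ η * δ := by nlinarith
        nlinarith
      · linarith [h_far (dist z y) (by linarith), hfs y y.2, hF0 w]

theorem ofReal_dist_le_chainDist {n : ℕ} (X : Set (Euc n)) (δ : ℝ) (a x : Euc n) :
    ENNReal.ofReal (dist a x) ≤ chainDist X δ a x := by
  unfold chainDist
  refine le_iInf fun j => le_iInf fun p => le_iInf fun _ => le_iInf fun h0 => le_iInf fun hj =>
    le_iInf fun _ => ENNReal.ofReal_le_ofReal ?_
  rw [← h0, ← hj]
  refine (dist_le_range_sum_dist p j).trans_eq ?_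
  exact Finset.sum_congr rfl fun i _ => dist_comm _ _

theorem chainDist_le_chainDist_add {n : ℕ} {X : Set (Euc n)} {δ : ℝ} (a : Euc n) {x y : Euc n}
    (hy : y ∈ X) (hxy : dist x y ≤ δ) :
    chainDist X δ a y ≤ chainDist X δ a x + ENNReal.ofReal (dist x y) := by
  rw [← tsub_le_iff_right]
  conv_rhs => unfold chainDist
  refine le_iInf fun j => le_iInf fun p => le_iInf fun hp => le_iInf fun h0 => le_iInf fun hj =>
    le_iInf fun hδ => ?_
  rw [tsub_le_iff_right, ← ENNReal.ofReal_add (Finset.sum_nonneg fun _ _ => dist_nonneg)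
    dist_nonneg]
  let q : ℕ → Euc n := fun i => if i ≤ j then p i else y
  have hq : ∀ i, i ≤ j → q i = p i := fun i hi => if_pos hi
  have hqj : q (j + 1) = y := if_neg (by omega)
  unfold chainDist
  refine iInf_le_of_le (j + 1) <| iInf_le_of_le q <| iInf_le_of_le ?_ <| iInf_le_of_le ?_ <|
    iInf_le_of_le hqj <| iInf_le_of_le ?_ <| ENNReal.ofReal_le_ofReal ?_
  · intro i hi
    rcases Nat.le_succ_iff.1 hi with hi | rfl
    · rw [hq i hi]
      exact hp i hi
    · rwa [hqj]
  · rw [hq 0 (Nat.zero_le j), h0]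
  · intro i hi1 hi
    rcases Nat.le_succ_iff.1 hi with hi | rfl
    · rw [hq i hi, hq (i - 1) (by omega)]
      exact hδ i hi1 hi
    · rw [hqj, Nat.succ_sub_one, hq j le_rfl, hj, dist_comm]
      exact hxy
  · rw [Finset.sum_range_succ, hqj, hq j le_rfl, hj, dist_comm y x]
    refine add_le_add (Finset.sum_le_sum fun i hi => ?_) le_rfl
    have := Finset.mem_range.1 hi
    rw [hq i (by omega), hq (i + 1) (by omega)]

/-- Let `X ⊆ ℝⁿ` be closed, `ε > 0`, `0 ≤ s < ∞`, `0 < δ ≤ 1`, `a ∈ X`,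
and let `ζ(x) = max (s − σ_δ(x,a)) 0` (with value `0` when `σ_δ(x,a) = ∞`).  Then there is a
nonnegative smooth compactly supported `Z : ℝⁿ → ℝ` with `|Z(x) − ζ(x)| ≤ ε` and
`|DZ(x)| ≤ 1` for every `x ∈ X`. -/
theorem exists_smooth_approx_chain_cutoff {n : ℕ} (X : Set (Euc n)) (hX : IsClosed X)
    (ε : ℝ) (hε : 0 < ε) (s : ℝ) (hs : 0 ≤ s) (δ : ℝ) (hδ0 : 0 < δ) (hδ1 : δ ≤ 1)
    (a : Euc n) (ha : a ∈ X) (ζ : Euc n → ℝ)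
    (hζ : ∀ x, ζ x = (ENNReal.ofReal s - chainDist X δ a x).toReal) :
    ∃ Z : Euc n → ℝ, ContDiff ℝ (⊤ : ℕ∞) Z ∧ HasCompactSupport Z ∧ (∀ x, 0 ≤ Z x) ∧
      ∀ x ∈ X, |Z x - ζ x| ≤ ε ∧ ‖fderiv ℝ Z x‖ ≤ 1 := by
  have hζ0 : ∀ x, 0 ≤ ζ x := fun x => by rw [hζ]; exact ENNReal.toReal_nonneg
  have hζs : ∀ x, ζ x ≤ s := fun x => by
    rw [hζ]
    exact ENNReal.toReal_le_of_le_ofReal hs tsub_le_self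
  have hζsupp : ∀ x, 0 < ζ x → dist a x ≤ s := by
    intro x hx
    by_contra! hlt
    have : ENNReal.ofReal s ≤ chainDist X δ a x :=
      (ENNReal.ofReal_le_ofReal hlt.le).trans (ofReal_dist_le_chainDist X δ a x)
    rw [hζ, tsub_eq_zero_of_le this, ENNReal.toReal_zero] at hx
    exact lt_irrefl _ hx
  have hζlip : ∀ x ∈ X, ∀ y ∈ X, dist x y ≤ δ → ζ y ≤ ζ x + dist x y := by
    intro x hx y _ hxy
    have h1 := chainDist_le_chainDist_add a hx ((dist_comm y x).trans_le hxy)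
    have hfin : ENNReal.ofReal s - chainDist X δ a x ≠ ⊤ :=
      ENNReal.sub_ne_top ENNReal.ofReal_ne_top
    have h2 : ENNReal.ofReal s - chainDist X δ a y ≤
        ENNReal.ofReal s - chainDist X δ a x + ENNReal.ofReal (dist x y) := by
      rw [tsub_le_iff_right]
      calc ENNReal.ofReal s
          ≤ ENNReal.ofReal s - chainDist X δ a x + chainDist X δ a x := le_tsub_add
        _ ≤ ENNReal.ofReal s - chainDist X δ a x +
            (chainDist X δ a y + ENNReal.ofReal (dist y x)) := by gcongr
        _ = _ := by rw [dist_comm y x]; ring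
    rw [hζ, hζ]
    have h3 := ENNReal.toReal_mono (ENNReal.add_ne_top.2 ⟨hfin, ENNReal.ofReal_ne_top⟩) h2
    rwa [ENNReal.toReal_add hfin ENNReal.ofReal_ne_top, ENNReal.toReal_ofReal dist_nonneg] at h3
  obtain ⟨η, hη0, hη1, hηs⟩ : ∃ η : ℝ, 0 < η ∧ η ≤ 1 ∧ η * s ≤ ε / 2 := by
    refine ⟨min 1 (ε / (2 * (s + 1))), by positivity, min_le_left _ _, ?_⟩
    calc min 1 (ε / (2 * (s + 1))) * s ≤ ε / (2 * (s + 1)) * (s + 1) := by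
          gcongr
          · exact min_le_right _ _
          · linarith
      _ = ε / 2 := by field_simp
  obtain ⟨F, hFc, hF0, hFsupp, hFX, hFlip⟩ :=
    exists_continuous_extension_of_lipschitz_at_scale ⟨a, ha⟩ hδ0 hη0 hη1 (fun x _ => hζ0 x)
      (fun x _ => hζs x) hζlip
  have hFs : HasCompactSupport F := by
    refine HasCompactSupport.intro (isCompact_closedBall a (2 * s)) fun z hz => ?_
    by_contra hne
    obtain ⟨y, _, hy, hzy⟩ := hFsupp z (lt_of_le_of_ne (hF0 z) (Ne.symm hne))
    refine hz (mem_closedBall.2 ?_)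
    linarith [dist_triangle_right z a y, hζsupp y hy]
  have hr : 0 < min (η * δ / 20) (ε / 4) := by positivity
  obtain ⟨W, hWc, hWs, hW0, hW⟩ :=
    exists_contDiff_mollification hFc hFs hF0 (by linarith : 0 ≤ 1 + η) hr
  have hη' : 0 < 1 + η := by linarith
  refine ⟨fun z => (1 + η)⁻¹ * W z, contDiff_const.mul hWc, hWs.mul_left,
    fun z => mul_nonneg (by positivity) (hW0 z), fun x hx => ?_⟩
  obtain ⟨h1, h2⟩ := hW x fun z hz w hw =>
    hFlip x hx z (ball_subset_ball (min_le_left _ _) hz) w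
      (ball_subset_ball (min_le_left _ _) hw)
  constructor
  · rw [hFX x hx] at h1
    have h3 : (1 + η)⁻¹ * W x - ζ x = (1 + η)⁻¹ * (W x - ζ x - η * ζ x) := by
      field_simp
      ring
    have h4 : (1 + η) * min (η * δ / 20) (ε / 4) ≤ 2 * (ε / 4) := by
      gcongr
      · linarith
      · exact min_le_right _ _
    have h5 : 0 ≤ η * ζ x := mul_nonneg hη0.le (hζ0 x)
    have h6 : η * ζ x ≤ η * s := mul_le_mul_of_nonneg_left (hζs x) hη0.le
    have h7 : |W x - ζ x - η * ζ x| ≤ ε := by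
      rw [abs_le] at h1 ⊢
      constructor <;> linarith
    rw [h3, abs_mul, abs_of_pos (inv_pos.2 hη')]
    exact (mul_le_of_le_one_left (abs_nonneg _) (inv_le_one_of_one_le₀ (by linarith))).trans h7
  · rw [fderiv_const_mul (hWc.differentiable (by simp) x), norm_smul, Real.norm_eq_abs,
      abs_of_pos (inv_pos.2 hη')]
    exact (inv_mul_le_one₀ hη').2 h2

end
end
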